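/- Fix an integer d ≥ 1. Let S ⊆ ℂ^d be the set of tuples t = (t₁, …, t_d) such that the monic polynomial P_t(y) = y^d + t₁·y^{d−1} + … + t_d has d distinct complex roots (equivalently, its discriminant is nonzero), and let E = {(t, y) ∈ S × ℂ : P_t(y) = 0}. Then the projection map E → S, (t, y) ↦ t, with the Euclidean topologies, is a topological cover, and every fiber has exactly d elements. -/

import Mathlib

namespace MonicRootsCover

/-- The monic polynomial `P_t(y) = y^d + t₁·y^{d−1} + … + t_d` attached to a tuple
`t = (t₁, …, t_d) ∈ ℂ^d` (here `t i` multiplies `y^(d-1-i)` for `i : Fin d`). -/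
noncomputable def P (d : ℕ) (t : Fin d → ℂ) : Polynomial ℂ :=
  Polynomial.X ^ d + ∑ i : Fin d, Polynomial.C (t i) * Polynomial.X ^ (d - 1 - (i : ℕ))

/-- The set `S ⊆ ℂ^d` of tuples `t` such that `P_t` has `d` distinct complex roots
(equivalently, its discriminant is nonzero). -/
def S (d : ℕ) : Set (Fin d → ℂ) := {t | (P d t).roots.toFinset.card = d}

/-- The incidence set `E = {(t, y) ∈ S × ℂ : P_t(y) = 0}`. -/
def E (d : ℕ) : Set ((Fin d → ℂ) × ℂ) := {p | p.1 ∈ S d ∧ (P d p.1).IsRoot p.2}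

/-- The projection `E → S`, `(t, y) ↦ t`. -/
def proj (d : ℕ) (p : E d) : S d := ⟨p.1.1, p.2.1⟩

open Polynomial Filter Topology

/-- The polynomial function `(t, y) ↦ P_t(y)` on `ℂ^d × ℂ`. -/
noncomputable def F (d : ℕ) (p : (Fin d → ℂ) × ℂ) : ℂ :=
  p.2 ^ d + ∑ i : Fin d, p.1 i * p.2 ^ (d - 1 - (i : ℕ))

lemma eval_P (d : ℕ) (t : Fin d → ℂ) (y : ℂ) : (P d t).eval y = F d (t, y) := by
  simp [P, F, eval_finsetSum]

lemma degree_aux (d : ℕ) (hd : 1 ≤ d) (t : Fin d → ℂ) :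
    (∑ i : Fin d, C (t i) * X ^ (d - 1 - (i : ℕ))).degree < (d : WithBot ℕ) := by
  refine (degree_sum_le _ _).trans_lt ?_
  refine (Finset.sup_lt_iff (WithBot.bot_lt_coe d)).2 ?_
  intro i _
  refine (degree_C_mul_X_pow_le _ _).trans_lt ?_
  exact WithBot.coe_lt_coe.2 (by omega : d - 1 - (i : ℕ) < d)

lemma monic_P (d : ℕ) (hd : 1 ≤ d) (t : Fin d → ℂ) : (P d t).Monic :=
  monic_X_pow_add (degree_aux d hd t)

lemma natDegree_P (d : ℕ) (hd : 1 ≤ d) (t : Fin d → ℂ) : (P d t).natDegree = d := by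
  apply natDegree_eq_of_degree_eq_some
  rw [P, degree_add_eq_left_of_degree_lt] <;> rw [degree_X_pow]
  exact degree_aux d hd t

lemma deriv_ne (d : ℕ) (hd : 1 ≤ d) (t : Fin d → ℂ) (ht : t ∈ S d) (y : ℂ)
    (hy : (P d t).IsRoot y) : (P d t).derivative.eval y ≠ 0 := by
  have h0 := (monic_P d hd t).ne_zero
  have hnd : (P d t).roots.Nodup := by
    rw [← Multiset.toFinset_card_eq_card_iff_nodup]
    apply le_antisymm (Multiset.toFinset_card_le _)
    have h1 : (P d t).roots.toFinset.card = d := ht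
    rw [h1]
    exact (card_roots' _).trans (natDegree_P d hd t).le
  intro h
  have h2 : 1 < (P d t).rootMultiplicity y :=
    (one_lt_rootMultiplicity_iff_isRoot h0).2 ⟨hy, h⟩
  have h3 := Multiset.nodup_iff_count_le_one.1 hnd y
  rw [count_roots] at h3
  omega

lemma contDiff_F (d : ℕ) : ContDiff ℂ 1 (F d) := by
  unfold F
  fun_prop

lemma invertible_F (d : ℕ) (hd : 1 ≤ d) (u : (Fin d → ℂ) × ℂ) (hu : u ∈ E d) :
    (fderiv ℂ (F d) u ∘L .inr ℂ (Fin d → ℂ) ℂ).IsInvertible := by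
  have h1 : HasFDerivAt (F d) (fderiv ℂ (F d) u) (u.1, u.2) :=
    ((contDiff_F d).differentiable (by norm_num) u).hasFDerivAt
  have h2 : HasFDerivAt (fun y : ℂ => F d (u.1, y))
      (fderiv ℂ (F d) u ∘L .inr ℂ (Fin d → ℂ) ℂ) u.2 :=
    h1.comp u.2 (hasFDerivAt_prodMk_right u.1 u.2)
  have h3 : HasDerivAt (fun y : ℂ => F d (u.1, y)) ((P d u.1).derivative.eval u.2) u.2 := by
    simpa only [eval_P] using (P d u.1).hasDerivAt u.2
  have hne := deriv_ne d hd u.1 hu.1 u.2 hu.2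
  rw [h2.unique h3.hasFDerivAt]
  refine ⟨ContinuousLinearEquiv.unitsEquivAut ℂ (Units.mk0 _ hne), ?_⟩
  ext
  simp

lemma continuous_proj (d : ℕ) : Continuous (proj d) := by
  unfold proj
  fun_prop

lemma exists_local (d : ℕ) (hd : 1 ≤ d) (e : E d) :
    ∃ ψ : (Fin d → ℂ) → ℂ, ContinuousAt ψ e.1.1 ∧ ψ e.1.1 = e.1.2 ∧
      (∀ᶠ t in 𝓝 e.1.1, F d (t, ψ t) = 0) ∧
      ∀ᶠ v in 𝓝 e.1, F d v = 0 → ψ v.1 = v.2 := by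
  have hF : F d e.1 = 0 := by
    have := e.2.2
    rwa [IsRoot.def, eval_P] at this
  have cd : ContDiffAt ℂ 1 (F d) e.1 := (contDiff_F d).contDiffAt
  have hi := invertible_F d hd e.1 e.2
  refine ⟨cd.implicitFunction one_ne_zero hi,
    (cd.contDiffAt_implicitFunction one_ne_zero hi).continuousAt,
    cd.implicitFunction_apply_self one_ne_zero hi, ?_, ?_⟩
  · simpa only [hF] using cd.eventually_apply_implicitFunction one_ne_zero hi
  · filter_upwards [cd.eventually_apply_eq_iff_implicitFunction one_ne_zero hi] with v hv h
    exact hv.1 (h.trans hF.symm)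

lemma isOpenMap_proj (d : ℕ) (hd : 1 ≤ d) : IsOpenMap (proj d) := by
  rw [isOpenMap_iff_nhds_le]
  intro e W hW
  obtain ⟨ψ, hc, h0, hz, -⟩ := exists_local d hd e
  rw [mem_map, nhds_subtype_eq_comap, mem_comap] at hW
  obtain ⟨V, hV, hVW⟩ := hW
  have ht : Tendsto (fun t => (t, ψ t)) (𝓝 e.1.1) (𝓝 e.1) := by
    have : ContinuousAt (fun t => (t, ψ t)) e.1.1 := continuousAt_id.prodMk hc
    rw [ContinuousAt, h0] at this
    exact this
  have hev := (ht.eventually_mem hV).and hz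
  have hs : Tendsto (Subtype.val : S d → _) (𝓝 (proj d e)) (𝓝 e.1.1) :=
    continuous_subtype_val.continuousAt
  filter_upwards [hs.eventually hev] with t h
  have hE : ((t.1, ψ t.1) : (Fin d → ℂ) × ℂ) ∈ E d :=
    ⟨t.2, by rw [IsRoot.def, eval_P]; exact h.2⟩
  exact hVW (a := ⟨_, hE⟩) h.1

lemma isLocalHomeomorph_proj (d : ℕ) (hd : 1 ≤ d) : IsLocalHomeomorph (proj d) := by
  rw [isLocalHomeomorph_iff_isOpenEmbedding_restrict]
  intro e
  obtain ⟨ψ, -, -, -, hu⟩ := exists_local d hd e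
  obtain ⟨V, hV, hVo, heV⟩ := eventually_nhds_iff.1 hu
  have hUo : IsOpen (Subtype.val ⁻¹' V : Set (E d)) := hVo.preimage continuous_subtype_val
  refine ⟨Subtype.val ⁻¹' V, hUo.mem_nhds heV, ?_⟩
  refine .of_continuous_injective_isOpenMap ((continuous_proj d).comp continuous_subtype_val) ?_
    ((isOpenMap_proj d hd).comp hUo.isOpenMap_subtype_val)
  have key : ∀ a : E d, a.1 ∈ V → ψ a.1.1 = a.1.2 := fun a ha => hV _ ha (by
    have := a.2.2
    rwa [IsRoot.def, eval_P] at this)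
  rintro ⟨a, ha⟩ ⟨b, hb⟩ hab
  have h1 : a.1.1 = b.1.1 := congrArg Subtype.val hab
  have h2 : a.1.2 = b.1.2 := by rw [← key a ha, ← key b hb, h1]
  exact Subtype.ext (Subtype.ext (Prod.ext h1 h2))

lemma root_bound (d : ℕ) (hd : 1 ≤ d) (t : Fin d → ℂ) (y : ℂ) (h : F d (t, y) = 0) :
    ‖y‖ ≤ max 1 (d * ‖t‖) := by
  rcases le_or_gt ‖y‖ 1 with h1 | h1
  · exact h1.trans (le_max_left _ _)
  refine le_trans ?_ (le_max_right _ _)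
  have hpos : 0 < ‖y‖ ^ (d - 1) := by positivity
  refine le_of_mul_le_mul_right ?_ hpos
  calc ‖y‖ * ‖y‖ ^ (d - 1) = ‖y ^ d‖ := by
        rw [← pow_succ', norm_pow]; congr 1; omega
    _ = ‖∑ i : Fin d, t i * y ^ (d - 1 - (i : ℕ))‖ := by
        rw [eq_neg_of_add_eq_zero_left h, norm_neg]
    _ ≤ ∑ i : Fin d, ‖t‖ * ‖y‖ ^ (d - 1) := by
        refine norm_sum_le_of_le _ fun i _ => ?_
        rw [norm_mul, norm_pow]
        exact mul_le_mul (norm_le_pi_norm t i) (pow_le_pow_right₀ h1.le (Nat.sub_le _ _))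
          (by positivity) (by positivity)
    _ = d * ‖t‖ * ‖y‖ ^ (d - 1) := by
        simp [mul_assoc]

lemma isClosedMap_proj (d : ℕ) (hd : 1 ≤ d) : IsClosedMap (proj d) := by
  intro A hA
  rw [← isSeqClosed_iff_isClosed]
  intro x t hx hxt
  choose a haA hax using hx
  have hFa : ∀ n, F d (a n).1 = 0 := fun n => by
    have := (a n).2.2
    rwa [IsRoot.def, eval_P] at this
  have hval : Tendsto (fun n => (a n).1.1) atTop (𝓝 t.1) := by
    have : Tendsto (fun n => (x n).1) atTop (𝓝 t.1) :=
      (continuous_subtype_val.tendsto t).comp hxt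
    refine this.congr fun n => ?_
    rw [← hax n]; rfl
  obtain ⟨R, hR⟩ := (Metric.isBounded_range_of_tendsto _ hval).exists_norm_le
  have hb : ∀ n, (a n).1.2 ∈ Metric.closedBall (0 : ℂ) (max 1 (d * R)) := fun n => by
    rw [mem_closedBall_zero_iff]
    refine (root_bound d hd _ _ (hFa n)).trans (max_le_max le_rfl ?_)
    gcongr
    exact hR _ ⟨n, rfl⟩
  obtain ⟨y, -, φ, hφ, hy⟩ := (isCompact_closedBall (0 : ℂ) _).tendsto_subseq hb
  have hlim : Tendsto (fun n => (a (φ n)).1) atTop (𝓝 (t.1, y)) :=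
    (hval.comp hφ.tendsto_atTop).prodMk_nhds hy
  have hF0 : F d (t.1, y) = 0 := by
    refine tendsto_nhds_unique (((contDiff_F d).continuous.tendsto _).comp hlim) ?_
    simp only [Function.comp_def, hFa]
    exact tendsto_const_nhds
  have hE : ((t.1, y) : (Fin d → ℂ) × ℂ) ∈ E d := ⟨t.2, by rw [IsRoot.def, eval_P]; exact hF0⟩
  refine ⟨⟨_, hE⟩, ?_, rfl⟩
  exact hA.mem_of_tendsto (tendsto_subtype_rng.2 hlim) (Eventually.of_forall fun n => haA _)

lemma fiber_ncard (d : ℕ) (hd : 1 ≤ d) (t : S d) : (proj d ⁻¹' {t}).ncard = d := by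
  have hinj : Set.InjOn (fun p : E d => p.1.2) (proj d ⁻¹' {t}) := by
    intro a ha b hb hab
    have h1 : a.1.1 = b.1.1 := congrArg Subtype.val (ha.trans hb.symm : proj d a = proj d b)
    exact Subtype.ext (Prod.ext h1 hab)
  have himg : (fun p : E d => p.1.2) '' (proj d ⁻¹' {t}) = ((P d t.1).roots.toFinset : Set ℂ) := by
    ext y
    have h0 := (monic_P d hd t.1).ne_zero
    simp only [Finset.mem_coe, Multiset.mem_toFinset, mem_roots h0]
    constructor
    · rintro ⟨a, rfl, rfl⟩
      exact a.2.2
    · intro hy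
      exact ⟨⟨(t.1, y), t.2, hy⟩, rfl, rfl⟩
  rw [← hinj.ncard_image, himg, Set.ncard_coe_finset]
  exact t.2

/-- for `d ≥ 1`, the projection `E → S`, `(t, y) ↦ t` (with the Euclidean
topologies) is a topological cover, and every fiber has exactly `d` elements. -/
theorem proj_isCoveringMap_and_fibers_card (d : ℕ) (hd : 1 ≤ d) :
    Function.Surjective (proj d) ∧ IsCoveringMap (proj d) ∧
      ∀ t : S d, (proj d ⁻¹' {t}).ncard = d := by
  have hcard := fiber_ncard d hd
  have hfin : ∀ t : S d, (proj d ⁻¹' {t}).Finite := fun t =>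
    Set.finite_of_ncard_ne_zero (by rw [hcard t]; omega)
  refine ⟨fun t => ?_, ?_, hcard⟩
  · obtain ⟨a, ha⟩ := Set.nonempty_of_ncard_ne_zero
      (s := proj d ⁻¹' {t}) (by rw [hcard t]; omega)
    exact ⟨a, ha⟩
  · rw [isCoveringMap_iff_isCoveringMapOn_univ]
    exact (isClosedMap_proj d hd).isCoveringMapOn_of_isLocalHomeomorphOn (fun t _ => hfin t)
      (isLocalHomeomorph_proj d hd).isLocalHomeomorphOn

end MonicRootsCover
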